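/- Let m = n = 1 and let f : ℤ₊ → (0,1] be an arbitrary function. Then the set of real numbers γ ∈ (0,1) such that the function γ·f does NOT belong to the family 𝔉 is contained in a countable union of nowhere dense subsets of [0,1]; in particular this set is meagre, and there exists γ ∈ (0,1) with γ·f ∈ 𝔉. -/

import Mathlib

open scoped BigOperators

/-- `|q| = max_{1 ≤ i ≤ m} |q_i|` for an integer vector `q ∈ ℤ^m`. -/
def vecMax {m : ℕ} (q : Fin m → ℤ) : ℕ :=
  Finset.univ.sup fun i => (q i).natAbs

/-- `‖Θq‖ = min_{p ∈ ℤⁿ} max_{1 ≤ j ≤ n} |(Θq)_j − p_j|`. -/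
noncomputable def approxNorm {m n : ℕ} (Θ : Fin n → Fin m → ℝ) (q : Fin m → ℤ) : ℝ :=
  ⨅ p : Fin n → ℤ, ⨆ j : Fin n, |(∑ i, Θ j i * (q i : ℝ)) - (p j : ℝ)|

/-- Membership in `ℛ`: all entries of the `n × m` matrix lie in `[0,1]`. -/
def memR {m n : ℕ} (Θ : Fin n → Fin m → ℝ) : Prop :=
  ∀ j : Fin n, ∀ i : Fin m, Θ j i ∈ Set.Icc (0:ℝ) 1

/-- Membership in `𝓜^c[f] = ⋃_{Q ∈ ℤ₊} ⋂_{q ∈ ℤ^m, |q| ≥ Q} M_q^c[f]`, where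
`M_q^c[f] = ℛ \ {Θ ∈ ℛ : ‖Θq‖ < f(|q|)/(2|q|^{m/n})}`. -/
def memMc (m n : ℕ) (f : ℕ → ℝ) (Θ : Fin n → Fin m → ℝ) : Prop :=
  memR Θ ∧ ∃ Q : ℕ, 0 < Q ∧ ∀ q : Fin m → ℤ, q ≠ 0 → Q ≤ vecMax q →
    f (vecMax q) / (2 * (vecMax q : ℝ) ^ ((m : ℝ) / n)) ≤ approxNorm Θ q

/-- Membership in the family `𝔉`: `f` is positive-valued on `ℤ₊` and there is `Q = Q[f] ∈ ℤ₊`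
such that for every `Θ ∈ 𝓜^c[f]` and every nonzero `q ∈ ℤ^m` with `|q| ≥ Q` one has
`|q|^{m/n} · ‖Θq‖ ≠ f(|q|)`. -/
def memF (m n : ℕ) (f : ℕ → ℝ) : Prop :=
  (∀ x : ℕ, 1 ≤ x → 0 < f x) ∧
  ∃ Q : ℕ, 0 < Q ∧ ∀ Θ : Fin n → Fin m → ℝ, memMc m n f Θ →
    ∀ q : Fin m → ℤ, q ≠ 0 → Q ≤ vecMax q →
      (vecMax q : ℝ) ^ ((m : ℝ) / n) * approxNorm Θ q ≠ f (vecMax q)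

theorem vecMax_fin_one (q : Fin 1 → ℤ) : vecMax q = (q 0).natAbs := by
  simp [vecMax]

theorem approxNorm_fin_one (Θ : Fin 1 → Fin 1 → ℝ) (q : Fin 1 → ℤ) :
    approxNorm Θ q = |Θ 0 0 * (q 0 : ℝ) - (round (Θ 0 0 * (q 0 : ℝ)) : ℝ)| := by
  simp only [approxNorm, Finset.univ_unique, Fin.default_eq_zero, Finset.sum_singleton,
    ciSup_unique]
  refine le_antisymm ?_ (le_ciInf fun p => round_le _ _)
  exact ciInf_le (f := fun p : Fin 1 → ℤ => |Θ 0 0 * (q 0 : ℝ) - (p 0 : ℝ)|)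
    ⟨0, Set.forall_mem_range.2 fun p => abs_nonneg _⟩
    (fun _ => round (Θ 0 0 * (q 0 : ℝ)))

/-- The parameters `γ ∈ [0,1]` for which every multiple `r ≥ Q` of the point `a + cγ` is at
distance at least `γ · g r` from the integers. -/
def badlyApproximableParams (g : ℕ → ℝ) (a c : ℝ) (Q : ℕ) : Set ℝ :=
  {γ | γ ∈ Set.Icc (0 : ℝ) 1 ∧ ∀ r : ℕ, 0 < r → Q ≤ r → ∀ z : ℤ, γ * g r ≤ |(a + c * γ) * r - z|}

theorem isClosed_badlyApproximableParams (g : ℕ → ℝ) (a c : ℝ) (Q : ℕ) :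
    IsClosed (badlyApproximableParams g a c Q) := by
  simp only [badlyApproximableParams, Set.ofPred_and, Set.ofPred_forall]
  refine isClosed_Icc.inter ?_
  refine isClosed_iInter fun r => isClosed_iInter fun _ => isClosed_iInter fun _ =>
    isClosed_iInter fun z => isClosed_le ?_ ?_ <;> fun_prop

theorem isNowhereDense_badlyApproximableParams {g : ℕ → ℝ} (hg : ∀ r, 0 < r → 0 < g r)
    (a : ℝ) {c : ℝ} (hc : c ≠ 0) (Q : ℕ) :
    IsNowhereDense (badlyApproximableParams g a c Q) := by
  rw [(isClosed_badlyApproximableParams g a c Q).isNowhereDense_iff]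
  by_contra hne
  have hne := Set.nonempty_iff_ne_empty.2 hne
  have hdense : Dense (Set.range fun t : ℚ => ((t : ℝ) - a) / c) := by
    have hs : Function.Surjective fun x : ℝ => (x - a) / c := fun y =>
      ⟨c * y + a, by field_simp; ring⟩
    exact hs.denseRange.comp Rat.denseRange_cast (by fun_prop)
  have hpos : (interior (badlyApproximableParams g a c Q) ∩ Set.Ioi 0).Nonempty := by
    obtain ⟨x, hx⟩ := hne
    have hx' : x ∈ closure (Set.Ioi (0 : ℝ)) := by
      rw [closure_Ioi]
      exact (interior_subset hx).1.1
    exact mem_closure_iff.1 hx' _ isOpen_interior hx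
  obtain ⟨_, ⟨hγ, hγ0⟩, t, rfl⟩ :=
    hdense.inter_open_nonempty _ (isOpen_interior.inter isOpen_Ioi) hpos
  have hr : 0 < t.den * (Q + 1) := Nat.mul_pos t.den_pos Q.succ_pos
  have hQ : Q ≤ t.den * (Q + 1) := by nlinarith [t.den_pos]
  have h := (interior_subset hγ).2 _ hr hQ (t.num * (Q + 1))
  have hzero : (a + c * (((t : ℝ) - a) / c)) * ((t.den * (Q + 1) : ℕ) : ℝ)
      - ((t.num * (Q + 1) : ℤ) : ℝ) = 0 := by
    have ht : (t : ℝ) * t.den = t.num := by exact_mod_cast Rat.mul_den_eq_num t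
    rw [mul_div_cancel₀ _ hc]
    push_cast
    linear_combination ((Q : ℝ) + 1) * ht
  rw [hzero, abs_zero] at h
  exact absurd h (not_le.2 (mul_pos hγ0 (hg _ hr)))

/-- If `γ · f` is not in the family, then some `p / q ± γ f(|q|) / q²` is badly approximable
with respect to `γ · f`; the sign is absorbed into that of `q`. -/
theorem exists_mem_badlyApproximableParams {f : ℕ → ℝ}
    (hf : ∀ x : ℕ, 1 ≤ x → f x ∈ Set.Ioc (0 : ℝ) 1) {γ : ℝ} (hγ : γ ∈ Set.Ioo (0 : ℝ) 1)
    (hF : ¬ memF 1 1 fun x : ℕ => γ * f x) :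
    ∃ (p q : ℤ) (Q : ℕ), q ≠ 0 ∧ γ ∈ badlyApproximableParams (fun r => f r / (2 * r))
      ((p : ℝ) / q) (f q.natAbs / (q.natAbs * q)) Q := by
  simp only [memF, not_and, not_exists] at hF
  have hF := hF (fun x hx => mul_pos hγ.1 (hf x hx).1) 1
  push Not at hF
  obtain ⟨Θ, ⟨-, Q, -, hQ⟩, q, hq, -, heq⟩ := hF one_pos
  simp only [vecMax_fin_one, approxNorm_fin_one, Nat.cast_one, div_one, Real.rpow_one] at hQ heq
  have hq0 : q 0 ≠ 0 := fun h => hq (funext fun i => by rw [Subsingleton.elim i 0, h]; rfl)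
  have hqR : (q 0 : ℝ) ≠ 0 := Int.cast_ne_zero.2 hq0
  have hnR : ((q 0).natAbs : ℝ) ≠ 0 := Nat.cast_ne_zero.2 (Int.natAbs_ne_zero.2 hq0)
  have key : ∀ p k : ℤ, k ≠ 0 →
      Θ 0 0 = (p : ℝ) / k + f k.natAbs / (k.natAbs * k) * γ →
      ∃ (p q : ℤ) (Q : ℕ), q ≠ 0 ∧ γ ∈ badlyApproximableParams (fun r => f r / (2 * r))
        ((p : ℝ) / q) (f q.natAbs / (q.natAbs * q)) Q := by
    refine fun p k hk hΘ => ⟨p, k, Q, hk, ⟨hγ.1.le, hγ.2.le⟩, fun r hr hQr z => ?_⟩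
    rw [← hΘ, ← mul_div_assoc]
    have h := hQ (fun _ => (r : ℤ)) (fun h => hr.ne' (by simpa using congrFun h 0)) (by simpa)
    simp only [Int.natAbs_natCast, Int.cast_natCast] at h
    exact h.trans (round_le _ _)
  rcases abs_choice (Θ 0 0 * (q 0 : ℝ) - (round (Θ 0 0 * (q 0 : ℝ)) : ℝ)) with h | h
  · rw [h] at heq
    refine key (round (Θ 0 0 * (q 0 : ℝ))) (q 0) hq0 ?_
    field_simp
    linear_combination heq
  · rw [h] at heq
    refine key (-round (Θ 0 0 * (q 0 : ℝ))) (-q 0) (neg_ne_zero.2 hq0) ?_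
    rw [Int.natAbs_neg]
    push_cast
    field_simp
    linear_combination -heq

/-- For `m = n = 1` and arbitrary `f : ℤ₊ → (0,1]`, the set of `γ ∈ (0,1)` with
`γ·f ∉ 𝔉` is contained in a countable union of nowhere dense subsets of `[0,1]`; in
particular it is meagre, and there exists `γ ∈ (0,1)` with `γ·f ∈ 𝔉`. -/
theorem statement10 (f : ℕ → ℝ) (hf : ∀ x : ℕ, 1 ≤ x → f x ∈ Set.Ioc (0:ℝ) 1) :
    (∃ S : ℕ → Set ℝ,
      (∀ k : ℕ, S k ⊆ Set.Icc (0:ℝ) 1 ∧ IsNowhereDense (S k)) ∧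
      {γ : ℝ | γ ∈ Set.Ioo (0:ℝ) 1 ∧ ¬ memF 1 1 (fun x : ℕ => γ * f x)} ⊆ ⋃ k, S k) ∧
    IsMeagre {γ : ℝ | γ ∈ Set.Ioo (0:ℝ) 1 ∧ ¬ memF 1 1 (fun x : ℕ => γ * f x)} ∧
    ∃ γ ∈ Set.Ioo (0:ℝ) 1, memF 1 1 (fun x : ℕ => γ * f x) := by
  have hcover : ∃ S : ℕ → Set ℝ,
      (∀ k : ℕ, S k ⊆ Set.Icc (0:ℝ) 1 ∧ IsNowhereDense (S k)) ∧
      {γ : ℝ | γ ∈ Set.Ioo (0:ℝ) 1 ∧ ¬ memF 1 1 (fun x : ℕ => γ * f x)} ⊆ ⋃ k, S k := by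
    have : Nonempty (ℤ × {q : ℤ // q ≠ 0} × ℕ) := ⟨(0, ⟨1, one_ne_zero⟩, 0)⟩
    obtain ⟨e, he⟩ := exists_surjective_nat (ℤ × {q : ℤ // q ≠ 0} × ℕ)
    refine ⟨fun k => badlyApproximableParams (fun r => f r / (2 * r))
      (((e k).1 : ℝ) / (e k).2.1.1)
      (f (e k).2.1.1.natAbs / ((e k).2.1.1.natAbs * (e k).2.1.1)) (e k).2.2,
      fun k => ⟨fun γ hγ => hγ.1, isNowhereDense_badlyApproximableParams ?_ _ ?_ _⟩, ?_⟩
    · intro r hr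
      have := (hf r hr).1
      positivity
    · have hq := (e k).2.1.2
      have hn := Int.natAbs_ne_zero.2 hq
      exact div_ne_zero (hf _ (Nat.one_le_iff_ne_zero.2 hn)).1.ne'
        (mul_ne_zero (Nat.cast_ne_zero.2 hn) (Int.cast_ne_zero.2 hq))
    · rintro γ ⟨hγ, hF⟩
      obtain ⟨p, q, Q, hq, hmem⟩ := exists_mem_badlyApproximableParams hf hγ hF
      obtain ⟨k, hk⟩ := he (p, ⟨q, hq⟩, Q)
      refine Set.mem_iUnion.2 ⟨k, ?_⟩
      simpa only [hk] using hmem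
  have hmeagre : IsMeagre {γ : ℝ | γ ∈ Set.Ioo (0:ℝ) 1 ∧ ¬ memF 1 1 (fun x : ℕ => γ * f x)} := by
    obtain ⟨S, hS, hsub⟩ := hcover
    exact (isMeagre_iUnion fun k => (hS k).2.isMeagre).mono hsub
  refine ⟨hcover, hmeagre, ?_⟩
  obtain ⟨γ, hγ, hmem⟩ := (dense_of_mem_residual hmeagre).inter_open_nonempty _
    isOpen_Ioo (Set.nonempty_Ioo.2 (zero_lt_one' ℝ))
  exact ⟨γ, hγ, by_contra fun h => hmem ⟨hγ, h⟩⟩
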